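/- arXiv:math/0606070 — 5 statements merged into one kernel-verified Lean document; each statement's English description precedes it below -/
import Mathlib

section
/- Let G be a group with a finite relative presentation (S,R) with respect to a family of subgroups H : Λ → Subgroup G. Let H' : Λ → Subgroup G satisfy H' λ ≤ H λ for every λ, let K' = K(S,H'), and let ι : K' →* K(S,H) be the homomorphism induced by the identity on FreeGroup S and the inclusions H' λ ≤ H λ. Suppose R' is a finite subset of K' whose image ι '' R' equals R. Then the kernel of the composite homomorphism ε ∘ ι : K' →* G equals the normal closure of R' in K'. (Consequently the subgroup of G generated by S together with all H' λ — the finitely generated core — has finite relative presentation ⟨S, {H' λ} | R'⟩.) -/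
/-- `K(S,H)`: the free product of the free group on `S` with the free product
of the family of subgroups `H`. -/
abbrev RelK {G : Type*} [Group G] {Λ : Type*} (S : Set G) (H : Λ → Subgroup G) : Type _ :=
  Monoid.Coprod (FreeGroup S) (Monoid.CoprodI (fun l => H l))

/-- The canonical homomorphism `ε : K(S,H) →* G` sending the free generator corresponding
to `s ∈ S` to `s` and each element of each `H λ` to itself. -/
def relEps {G : Type*} [Group G] {Λ : Type*} (S : Set G) (H : Λ → Subgroup G) :
    RelK S H →* G :=
  Monoid.Coprod.lift (FreeGroup.lift (fun s => (s : G)))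
    (Monoid.CoprodI.lift (fun l => (H l).subtype))

/-- `(S, R)` is a finite relative presentation of `G` with respect to the family of
subgroups `H`. -/
structure IsFinRelPres {G : Type*} [Group G] {Λ : Type*} (S : Set G) (H : Λ → Subgroup G)
    (R : Set (RelK S H)) : Prop where
  finS : S.Finite
  finR : R.Finite
  surj : Function.Surjective (relEps S H)
  ker_eq : (relEps S H).ker = Subgroup.normalClosure R

/-- The homomorphism `ι : K(S,H') →* K(S,H)` induced by the identity on `FreeGroup S`
and the inclusions `H' λ ≤ H λ`. -/
def relIota {G : Type*} [Group G] {Λ : Type*} (S : Set G) {H H' : Λ → Subgroup G}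
    (hle : ∀ l, H' l ≤ H l) : RelK S H' →* RelK S H :=
  Monoid.Coprod.map (MonoidHom.id (FreeGroup S))
    (Monoid.CoprodI.lift
      (fun l => (Monoid.CoprodI.of (M := fun l => H l)).comp (Subgroup.inclusion (hle l))))

universe vQ vB

/-- Two groups with a common subgroup embed compatibly in a third group. -/
theorem exists_amalgam {A : Type*} {Q : Type vQ} {B : Type vB} [Group A] [Group Q] [Group B]
    (f : A →* Q) (g : A →* B) (hf : Function.Injective f) (hg : Function.Injective g) :
    ∃ (P : Type (max vQ vB)) (_ : Group P) (a : Q →* P) (b : B →* P),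
      Function.Injective a ∧ ∀ x, b (g x) = a (f x) := by
  have h1 : Function.Injective ((MonoidHom.inl Q B).comp f) := by
    intro x y h
    exact hf (congrArg Prod.fst h)
  have h2 : Function.Injective ((MonoidHom.inr Q B).comp g) := by
    intro x y h
    exact hg (congrArg Prod.snd h)
  let φ := (MonoidHom.ofInjective h1).symm.trans (MonoidHom.ofInjective h2)
  refine ⟨HNNExtension (Q × B) _ _ φ, inferInstance,
    (MulAut.conj (HNNExtension.t (φ := φ))).toMonoidHom.comp
      ((HNNExtension.of (φ := φ)).comp (MonoidHom.inl Q B)),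
    (HNNExtension.of (φ := φ)).comp (MonoidHom.inr Q B), ?_, ?_⟩
  · intro x y h
    have h' := (MulAut.conj (HNNExtension.t (φ := φ))).injective h
    exact congrArg Prod.fst (HNNExtension.of_injective (φ := φ) h')
  · intro x
    have h := HNNExtension.t_mul_of (φ := φ) (MonoidHom.ofInjective h1 x)
    have h3 : φ (MonoidHom.ofInjective h1 x) = MonoidHom.ofInjective h2 x := by
      simp [φ]
    rw [h3] at h
    simp only [MonoidHom.ofInjective_apply] at h
    exact (mul_inv_eq_of_eq_mul h).symm

/-- If `(S,R)` is a finite relative presentation of `G` with respect to `{H λ}`,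
`H' λ ≤ H λ` for all `λ`, and `R'` is a finite subset of `K' = K(S,H')` with
`ι '' R' = R`, then the kernel of `ε ∘ ι : K' →* G` is the normal closure of `R'`. -/
theorem kernel_comp_eq_normalClosure_of_core
    {G : Type*} [Group G] {Λ : Type*} (S : Set G) (H H' : Λ → Subgroup G)
    (hle : ∀ l, H' l ≤ H l) (R : Set (RelK S H)) (hpres : IsFinRelPres S H R)
    (R' : Set (RelK S H')) (hR'fin : R'.Finite) (himg : (relIota S hle) '' R' = R) :
    ((relEps S H).comp (relIota S hle)).ker = Subgroup.normalClosure R' := by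
  have hR : ∀ r ∈ R', relEps S H (relIota S hle r) = 1 := by
    intro r hr
    have : relIota S hle r ∈ (relEps S H).ker := by
      rw [hpres.ker_eq]
      exact Subgroup.subset_normalClosure (himg ▸ Set.mem_image_of_mem _ hr)
    exact this
  have hle1 : Subgroup.normalClosure R' ≤ ((relEps S H).comp (relIota S hle)).ker :=
    Subgroup.normalClosure_le_normal (fun r hr => hR r hr)
  refine le_antisymm ?_ hle1
  let N := Subgroup.normalClosure R'
  let f : ∀ l, H' l →* (RelK S H' ⧸ N) := fun l =>
    (QuotientGroup.mk' N).comp (Monoid.Coprod.inr.comp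
      (Monoid.CoprodI.of (M := fun l => H' l) (i := l)))
  have hf : ∀ l, Function.Injective (f l) := by
    intro l x y h
    have h' := congrArg (QuotientGroup.lift N ((relEps S H).comp (relIota S hle)) hle1) h
    simpa [f, relEps, relIota] using h'
  choose P iP a b ha hb using fun l =>
    exists_amalgam (f l) (Subgroup.inclusion (hle l)) (hf l) (Subgroup.inclusion_injective (hle l))
  let β : (RelK S H' ⧸ N) →* Monoid.PushoutI a := Monoid.PushoutI.base a
  have hβ : Function.Injective β := Monoid.PushoutI.base_injective ha
  let Ψ : RelK S H →* Monoid.PushoutI a :=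
    Monoid.Coprod.lift
      ((β.comp (QuotientGroup.mk' N)).comp Monoid.Coprod.inl)
      (Monoid.CoprodI.lift (fun l => (Monoid.PushoutI.of (φ := a) l).comp (b l)))
  have hΨ : Ψ.comp (relIota S hle) = β.comp (QuotientGroup.mk' N) := by
    apply Monoid.Coprod.hom_ext
    · ext s
      simp [Ψ, relIota]
    · apply Monoid.CoprodI.ext_hom
      intro l
      ext x
      have h1 : β (f l x) = Monoid.PushoutI.of (φ := a) l (a l (f l x)) :=
        (Monoid.PushoutI.of_apply_eq_base a l (f l x)).symm
      rw [← hb l x] at h1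
      simpa [Ψ, relIota, f] using h1.symm
  have hker : (relEps S H).ker ≤ Ψ.ker := by
    rw [hpres.ker_eq]
    apply Subgroup.normalClosure_le_normal
    rw [← himg]
    rintro _ ⟨r, hr, rfl⟩
    have h := DFunLike.congr_fun hΨ r
    have h1 : QuotientGroup.mk' N r = 1 :=
      (QuotientGroup.eq_one_iff r).2 (Subgroup.subset_normalClosure hr)
    simp only [MonoidHom.comp_apply, h1, map_one] at h
    exact h
  intro x hx
  have h := DFunLike.congr_fun hΨ x
  have h2 : Ψ (relIota S hle x) = 1 := hker hx
  simp only [MonoidHom.comp_apply, h2] at h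
  have h3 : QuotientGroup.mk' N x = 1 := hβ (by rw [← h, map_one])
  exact (QuotientGroup.eq_one_iff x).1 h3
end

section
/- Let G be a group with a finite relative presentation (S,R) with respect to a family of subgroups H : Λ → Subgroup G, and let I ⊆ Λ be a subset such that every element of R lies in the range of the canonical homomorphism K(S, H restricted to I) →* K(S,H) (induced by the identity on FreeGroup S and the inclusions of the factors H i for i ∈ I). Let G₀ be the subgroup of G generated by S together with the subgroups H i for i ∈ I. Then G decomposes as the free product G₀ ∗ (∗_{λ ∈ Λ∖I} H λ): precisely, the canonical homomorphism from Monoid.Coprod G₀ (Monoid.CoprodI (fun λ : ↥(Λ \ I) => H λ)) to G induced by the subgroup inclusions is bijective. -/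
/-- The canonical homomorphism `K(S, H|_I) →* K(S, H)` induced by the identity on
`FreeGroup S` and the inclusions of the factors `H i` for `i ∈ I`. -/
def relRestr {G : Type*} [Group G] {Λ : Type*} (S : Set G) (H : Λ → Subgroup G) (I : Set Λ) :
    RelK S (fun i : I => H i) →* RelK S H :=
  Monoid.Coprod.map (MonoidHom.id (FreeGroup S))
    (Monoid.CoprodI.lift
      (fun i : I => (Monoid.CoprodI.of (M := fun l => H l) (i := (i : Λ)))))

/-- If `(S,R)` is a finite relative presentation of `G` with respect to `{H λ}` and every
relator lies in the image of `K(S, H|_I)`, then `G` splits as the free product of the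
subgroup `G₀` generated by `S` and the `H i`, `i ∈ I`, with the `H λ` for `λ ∉ I`:
the canonical homomorphism `G₀ ∗ (∗_{λ ∈ Λ∖I} H λ) →* G` is bijective. -/
theorem freeProduct_decomposition_of_relPres
    {G : Type*} [Group G] {Λ : Type*} (S : Set G) (H : Λ → Subgroup G)
    (R : Set (RelK S H)) (hpres : IsFinRelPres S H R) (I : Set Λ)
    (hR : ∀ r ∈ R, r ∈ Set.range (relRestr S H I)) :
    Function.Bijective
      (Monoid.Coprod.lift
        (Subgroup.closure (S ∪ ⋃ i ∈ I, (H i : Set G))).subtype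
        (Monoid.CoprodI.lift (fun l : ↥(Iᶜ) => (H l).subtype)) :
        Monoid.Coprod ↥(Subgroup.closure (S ∪ ⋃ i ∈ I, (H i : Set G)))
          (Monoid.CoprodI (fun l : ↥(Iᶜ) => H l)) →* G) := by
  classical
  set G₀ := Subgroup.closure (S ∪ ⋃ i ∈ I, (H i : Set G)) with hG₀
  have hS : ∀ s ∈ S, s ∈ G₀ := fun s hs => Subgroup.subset_closure (Or.inl hs)
  have hH : ∀ i ∈ I, H i ≤ G₀ := fun i hi x hx =>
    Subgroup.subset_closure (Or.inr (Set.mem_biUnion hi hx))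
  set π : Monoid.Coprod ↥G₀ (Monoid.CoprodI (fun l : ↥(Iᶜ) => H l)) →* G :=
    Monoid.Coprod.lift G₀.subtype
      (Monoid.CoprodI.lift (fun l : ↥(Iᶜ) => (H l).subtype)) with hπ
  -- the map on generators
  let f : FreeGroup S →* ↥G₀ := FreeGroup.lift (fun s => (⟨s, hS s s.2⟩ : G₀))
  let g : ∀ l : Λ, H l →* Monoid.Coprod ↥G₀ (Monoid.CoprodI (fun l : ↥(Iᶜ) => H l)) := fun l =>
    if h : l ∈ I then Monoid.Coprod.inl.comp (Subgroup.inclusion (hH l h))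
    else Monoid.Coprod.inr.comp
      (Monoid.CoprodI.of (M := fun l : ↥(Iᶜ) => H l) (i := ⟨l, h⟩))
  have hgI : ∀ l (h : l ∈ I), g l = Monoid.Coprod.inl.comp (Subgroup.inclusion (hH l h)) :=
    fun l h => dif_pos h
  have hgC : ∀ l (h : l ∉ I), g l = Monoid.Coprod.inr.comp
      (Monoid.CoprodI.of (M := fun l : ↥(Iᶜ) => H l) (i := ⟨l, h⟩)) :=
    fun l h => dif_neg h
  let φ : RelK S H →* Monoid.Coprod ↥G₀ (Monoid.CoprodI (fun l : ↥(Iᶜ) => H l)) :=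
    Monoid.Coprod.lift (Monoid.Coprod.inl.comp f) (Monoid.CoprodI.lift g)
  have hφS : ∀ s : S, φ (Monoid.Coprod.inl (FreeGroup.of s))
      = Monoid.Coprod.inl (⟨s, hS s s.2⟩ : G₀) := fun s => by
    simp [φ, f]
  have hφH : ∀ l (x : H l), φ (Monoid.Coprod.inr (Monoid.CoprodI.of x)) = g l x := fun l x => by
    simp [φ]
  have hcomp : π.comp φ = relEps S H := by
    apply Monoid.Coprod.hom_ext
    · apply FreeGroup.ext_hom
      intro s
      simp only [MonoidHom.comp_apply, hφS]
      simp [π, relEps]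
    · apply Monoid.CoprodI.ext_hom
      intro l
      ext x
      simp only [MonoidHom.comp_apply, hφH]
      by_cases h : l ∈ I
      · rw [hgI l h]; simp [π, relEps]
      · rw [hgC l h]; simp [π, relEps]
  have hsurj : Function.Surjective φ := by
    rw [← MonoidHom.range_eq_top, eq_top_iff, ← Monoid.Coprod.range_inl_sup_range_inr, sup_le_iff]
    constructor
    · rintro _ ⟨⟨x, hx⟩, rfl⟩
      induction hx using Subgroup.closure_induction with
      | mem x hx =>
        rcases hx with hx | hx
        · exact ⟨_, hφS ⟨x, hx⟩⟩
        · obtain ⟨i, hi, hxi⟩ := Set.mem_iUnion₂.1 hx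
          refine ⟨_, (hφH i ⟨x, hxi⟩).trans ?_⟩
          rw [hgI i hi]; rfl
      | one => exact ⟨1, (map_one φ).trans (map_one Monoid.Coprod.inl).symm⟩
      | mul x y hx hy ihx ihy => 
        have := mul_mem ihx ihy
        rwa [← map_mul] at this
      | inv x hx ihx =>
        have := inv_mem ihx
        rwa [← map_inv] at this
    · rintro _ ⟨x, rfl⟩
      induction x using Monoid.CoprodI.induction_on with
      | one => rw [map_one]; exact one_mem _
      | of i x =>
        refine ⟨_, (hφH i x).trans ?_⟩
        rw [hgC i i.2]; rfl
      | mul x y ihx ihy => rw [map_mul]; exact mul_mem ihx ihy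
  let ρ : RelK S (fun i : I => H i) →* G₀ :=
    Monoid.Coprod.lift f (Monoid.CoprodI.lift (fun i : I => Subgroup.inclusion (hH i i.2)))
  have hρ : φ.comp (relRestr S H I) = Monoid.Coprod.inl.comp ρ := by
    apply Monoid.Coprod.hom_ext
    · apply FreeGroup.ext_hom
      intro s
      simp [φ, ρ, relRestr]
    · apply Monoid.CoprodI.ext_hom
      intro l
      ext x
      simp [φ, ρ, relRestr, hgI l l.2]
  have hker : (relEps S H).ker ≤ φ.ker := by
    have hle : (relEps S H).ker ≤ φ.ker ↔ R ⊆ φ.ker := by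
      rw [hpres.ker_eq]
      exact ⟨fun h => Subgroup.subset_normalClosure.trans h, Subgroup.normalClosure_le_normal⟩
    rw [hle]
    intro r hr
    have hε : relEps S H r = 1 := by
      rw [← MonoidHom.mem_ker, hpres.ker_eq]
      exact Subgroup.subset_normalClosure hr
    obtain ⟨k, rfl⟩ := hR r hr
    have h1 : φ (relRestr S H I k) = Monoid.Coprod.inl (ρ k) := DFunLike.congr_fun hρ k
    rw [← hcomp, MonoidHom.comp_apply, h1] at hε
    have h2 : ρ k = 1 := by
      apply Subtype.ext
      simpa [π] using hε
    change φ _ = 1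
    rw [h1, h2, map_one]
  constructor
  · rw [injective_iff_map_eq_one]
    intro p hp
    obtain ⟨k, rfl⟩ := hsurj p
    apply hker
    change relEps S H k = 1
    rw [← hcomp]; exact hp
  · intro x
    obtain ⟨k, hk⟩ := hpres.surj x
    exact ⟨φ k, by rw [← hk, ← hcomp]; rfl⟩
end

section
/- Let H : ι → Type be a family of groups and for each i let K i be a normal subgroup of H i. Let N be the normal closure, in the free product Monoid.CoprodI H, of the union over i of the images of the sets (K i : Set (H i)) under the canonical injections of : H i →* Monoid.CoprodI H. Then the quotient (Monoid.CoprodI H) ⧸ N is isomorphic, as a group, to the free product Monoid.CoprodI (fun i => H i ⧸ K i), via the homomorphism induced by the quotient maps H i →* H i ⧸ K i on the factors. -/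
/-- The normal closure of the images of the `K i` is contained in the kernel of the
homomorphism `CoprodI H →* CoprodI (fun i => H i ⧸ K i)` induced by the quotient maps. -/
theorem normalClosure_le_ker_coprodIQuotient
    {ι : Type*} (H : ι → Type*) [∀ i, Group (H i)] (K : ∀ i, Subgroup (H i))
    [∀ i, (K i).Normal] :
    Subgroup.normalClosure (⋃ i, (Monoid.CoprodI.of '' ((K i : Set (H i)))))
      ≤ (Monoid.CoprodI.lift
          (fun i => (Monoid.CoprodI.of (M := fun i => H i ⧸ K i)).comp
            (QuotientGroup.mk' (K i)))).ker := by
  apply Subgroup.normalClosure_le_normal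
  rintro x hx
  rw [Set.mem_iUnion] at hx
  obtain ⟨i, k, hk, rfl⟩ := hx
  have h1 : (QuotientGroup.mk' (K i)) k = 1 := (QuotientGroup.eq_one_iff k).2 hk
  rw [SetLike.mem_coe, MonoidHom.mem_ker, Monoid.CoprodI.lift_of, MonoidHom.comp_apply, h1, map_one]

/-- The quotient of a free product `CoprodI H` by the normal closure of the union of the
images of normal subgroups `K i ⊴ H i` is isomorphic to the free product of the quotients
`H i ⧸ K i`, via the homomorphism induced by the quotient maps on the factors. -/
theorem coprodIQuotient_bijective
    {ι : Type*} (H : ι → Type*) [∀ i, Group (H i)] (K : ∀ i, Subgroup (H i))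
    [∀ i, (K i).Normal] :
    Function.Bijective
      (QuotientGroup.lift
        (Subgroup.normalClosure (⋃ i, (Monoid.CoprodI.of '' ((K i : Set (H i))))))
        (Monoid.CoprodI.lift
          (fun i => (Monoid.CoprodI.of (M := fun i => H i ⧸ K i)).comp
            (QuotientGroup.mk' (K i))))
        (normalClosure_le_ker_coprodIQuotient H K)) := by
  have hmem : ∀ i (k : H i), k ∈ K i →
      ((QuotientGroup.mk' (Subgroup.normalClosure
        (⋃ i, (Monoid.CoprodI.of '' ((K i : Set (H i)))))))).comp
        (Monoid.CoprodI.of (M := H) (i := i)) k = 1 := by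
    intro i k hk
    refine (QuotientGroup.eq_one_iff _).2 (Subgroup.subset_normalClosure ?_)
    exact Set.mem_iUnion.2 ⟨i, k, hk, rfl⟩
  let g : Monoid.CoprodI (fun i => H i ⧸ K i) →*
      Monoid.CoprodI H ⧸ (Subgroup.normalClosure
        (⋃ i, (Monoid.CoprodI.of '' ((K i : Set (H i)))))) :=
    Monoid.CoprodI.lift (fun i => QuotientGroup.lift (K i) _ (hmem i))
  refine Function.bijective_iff_has_inverse.2 ⟨g, ?_, ?_⟩
  · refine fun x => DFunLike.congr_fun (f := g.comp (QuotientGroup.lift _ _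
      (normalClosure_le_ker_coprodIQuotient H K)))
      (g := MonoidHom.id _) ?_ x
    apply QuotientGroup.monoidHom_ext
    apply Monoid.CoprodI.ext_hom
    intro i
    ext h
    simp [g]
    rfl
  · refine fun x => DFunLike.congr_fun (f := (QuotientGroup.lift _ _
      (normalClosure_le_ker_coprodIQuotient H K)).comp g)
      (g := MonoidHom.id _) ?_ x
    apply Monoid.CoprodI.ext_hom
    intro i
    apply QuotientGroup.monoidHom_ext
    ext h
    simp [g]
    exact Monoid.CoprodI.lift_of (fun i => (Monoid.CoprodI.of (M := fun i => H i ⧸ K i)).comp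
      (QuotientGroup.mk' (K i))) h
end

section
/- Let A and B be groups and let R ⊆ A. Then the quotient of the free product Monoid.Coprod A B by the normal closure of the image of R under the canonical injection inl : A →* Monoid.Coprod A B is isomorphic, as a group, to Monoid.Coprod (A ⧸ normalClosure R) B, via the homomorphism induced by the quotient map A →* A ⧸ normalClosure R on the first factor and the identity on the second factor. -/
/-- The normal closure of `inl '' R` is contained in the kernel of the homomorphism
`A ∗ B →* (A ⧸ normalClosure R) ∗ B` induced by the quotient map on the first factor. -/
theorem normalClosure_inl_le_ker
    {A B : Type*} [Group A] [Group B] (R : Set A) :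
    Subgroup.normalClosure ((Monoid.Coprod.inl : A →* Monoid.Coprod A B) '' R)
      ≤ (Monoid.Coprod.map (QuotientGroup.mk' (Subgroup.normalClosure R))
          (MonoidHom.id B)).ker := by
  apply Subgroup.normalClosure_le_normal
  rintro x ⟨a, ha, rfl⟩
  have h1 : (QuotientGroup.mk' (Subgroup.normalClosure R)) a = 1 :=
    (QuotientGroup.eq_one_iff a).2 (Subgroup.subset_normalClosure ha)
  rw [SetLike.mem_coe, MonoidHom.mem_ker, Monoid.Coprod.map_apply_inl, h1, map_one]

/-- The quotient of the free product `A ∗ B` by the normal closure of `inl '' R` is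
isomorphic to `(A ⧸ normalClosure R) ∗ B`, via the homomorphism induced by the quotient
map `A →* A ⧸ normalClosure R` on the first factor and the identity on the second. -/
theorem coprodQuotient_bijective
    {A B : Type*} [Group A] [Group B] (R : Set A) :
    Function.Bijective
      (QuotientGroup.lift
        (Subgroup.normalClosure ((Monoid.Coprod.inl : A →* Monoid.Coprod A B) '' R))
        (Monoid.Coprod.map (QuotientGroup.mk' (Subgroup.normalClosure R))
          (MonoidHom.id B))
        (normalClosure_inl_le_ker R)) := by
  let N := Subgroup.normalClosure ((Monoid.Coprod.inl : A →* Monoid.Coprod A B) '' R)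
  let π : Monoid.Coprod A B →* Monoid.Coprod A B ⧸ N := QuotientGroup.mk' N
  have hle : Subgroup.normalClosure R ≤ (π.comp Monoid.Coprod.inl).ker := by
    apply Subgroup.normalClosure_le_normal
    intro a ha
    rw [SetLike.mem_coe, MonoidHom.mem_ker]
    exact (QuotientGroup.eq_one_iff _).2 (Subgroup.subset_normalClosure ⟨a, ha, rfl⟩)
  let g : Monoid.Coprod (A ⧸ Subgroup.normalClosure R) B →* Monoid.Coprod A B ⧸ N :=
    Monoid.Coprod.lift (QuotientGroup.lift _ (π.comp Monoid.Coprod.inl) hle)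
      (π.comp Monoid.Coprod.inr)
  have hg : g.comp (Monoid.Coprod.map (QuotientGroup.mk' (Subgroup.normalClosure R))
      (MonoidHom.id B)) = π := by
    apply Monoid.Coprod.hom_ext
    · ext a
      simp [g]
    · ext b
      simp [g]
  constructor
  · apply Function.LeftInverse.injective (g := g)
    intro x
    obtain ⟨y, rfl⟩ := QuotientGroup.mk_surjective x
    exact DFunLike.congr_fun hg y
  · apply QuotientGroup.lift_surjective_of_surjective
    intro z
    induction z using Monoid.Coprod.induction_on with
    | inl q =>
      obtain ⟨a, rfl⟩ := QuotientGroup.mk_surjective q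
      exact ⟨Monoid.Coprod.inl a, by simp⟩
    | inr b => exact ⟨Monoid.Coprod.inr b, by simp⟩
    | mul x y hx hy =>
      obtain ⟨u, rfl⟩ := hx
      obtain ⟨v, rfl⟩ := hy
      exact ⟨u * v, map_mul _ _ _⟩
end

section
/- Let A, B : ι → Type be families of groups and for each i let f i : A i →* B i be an injective group homomorphism. Then the induced homomorphism Monoid.CoprodI A →* Monoid.CoprodI B (namely Monoid.CoprodI.lift of the compositions of f i with the canonical injections of : B i →* Monoid.CoprodI B) is injective. -/
/-- Every reduced word over `A` is sent to a reduced word over `B` with the same first index. -/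
theorem coprodI_map_word_aux
    {ι : Type*} (A B : ι → Type*) [∀ i, Group (A i)] [∀ i, Group (B i)]
    (f : ∀ i, A i →* B i) (hf : ∀ i, Function.Injective (f i))
    (w : Monoid.CoprodI.Word A) :
    ∃ w' : Monoid.CoprodI.Word B, w'.fstIdx = w.fstIdx ∧
      Monoid.CoprodI.lift (fun i => (Monoid.CoprodI.of (M := B)).comp (f i)) w.prod
        = w'.prod := by
  induction w using Monoid.CoprodI.Word.consRecOn with
  | empty => exact ⟨Monoid.CoprodI.Word.empty, rfl, by simp⟩
  | cons i m w h1 h2 ih =>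
    obtain ⟨w', hw, hp⟩ := ih
    refine ⟨Monoid.CoprodI.Word.cons (f i m) w' (by rw [hw]; exact h1)
      (fun h => h2 (hf i (h.trans (map_one (f i)).symm))), ?_, ?_⟩
    · simp
    · simp [hp]

/-- If `f i : A i →* B i` is a family of injective group homomorphisms, then the induced
homomorphism `CoprodI A →* CoprodI B` is injective. -/
theorem coprodI_map_injective
    {ι : Type*} (A B : ι → Type*) [∀ i, Group (A i)] [∀ i, Group (B i)]
    (f : ∀ i, A i →* B i) (hf : ∀ i, Function.Injective (f i)) :
    Function.Injective
      (Monoid.CoprodI.lift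
        (fun i => (Monoid.CoprodI.of (M := B)).comp (f i))) := by
  classical
  rw [injective_iff_map_eq_one]
  intro a ha
  obtain ⟨w, rfl⟩ := (Monoid.CoprodI.Word.equiv (M := A)).symm.surjective a
  change Monoid.CoprodI.lift _ w.prod = 1 at ha
  change w.prod = 1
  obtain ⟨w', hw, hp⟩ := coprodI_map_word_aux A B f hf w
  have h1 : w' = Monoid.CoprodI.Word.empty := by
    apply (Monoid.CoprodI.Word.equiv (M := B)).symm.injective
    change w'.prod = Monoid.CoprodI.Word.prod Monoid.CoprodI.Word.empty
    rw [← hp, ha, Monoid.CoprodI.Word.prod_empty]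
  subst h1
  induction w using Monoid.CoprodI.Word.consRecOn with
  | empty => simp
  | cons i m w h1 h2 ih =>
    rw [Monoid.CoprodI.Word.fstIdx_cons] at hw
    simp [Monoid.CoprodI.Word.fstIdx, Monoid.CoprodI.Word.empty] at hw
end
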